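/- Let ξ ∈ ℝ with 0 < ξ < α and Λ G(ξ) = λ G(α), and let u ∈ C²([0,R)) be the solution of the Cauchy problem M⁺(u'') + g(u) = 0, u(0) = ξ, u'(0) = 0 on its maximal interval of existence [0,R). Then R = +∞, −α < u(r) < α for all r ≥ 0, u is strictly decreasing on (0,+∞), and u(r) → −α as r → +∞. -/

import Mathlib

open Set Filter Topology

/-- A bounded Lipschitz vector field has integral curves on arbitrarily long time intervals. -/
lemma exists_hasDerivAt_of_lipschitzWith_of_norm_le {E : Type*} [NormedAddCommGroup E]
    [NormedSpace ℝ E] [CompleteSpace E] {F : E → E} {K L : NNReal} (hF : LipschitzWith K F)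
    (hL : ∀ x, ‖F x‖ ≤ L) (t₀ : ℝ) {T : ℝ} (hT : 0 < T) (x₀ : E) :
    ∃ γ : ℝ → E, γ t₀ = x₀ ∧ ∀ t ∈ Ioo (t₀ - T) (t₀ + T), HasDerivAt γ (F (γ t)) t := by
  have hmem : t₀ ∈ Icc (t₀ - T) (t₀ + T) := ⟨by linarith, by linarith⟩
  have hP : IsPicardLindelof (fun _ : ℝ => F) (⟨t₀, hmem⟩ : Icc (t₀ - T) (t₀ + T)) x₀
      (L * T.toNNReal) 0 L K :=
    { lipschitzOnWith := fun t _ => hF.lipschitzOnWith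
      continuousOn := fun x _ => continuousOn_const
      norm_le := fun t _ x _ => hL x
      mul_max_le := by simp [hT.le] }
  obtain ⟨γ, h0, hγ⟩ := hP.exists_eq_forall_mem_Icc_hasDerivWithinAt₀
  exact ⟨γ, h0, fun t ht => (hγ t (Ioo_subset_Icc_self ht)).hasDerivAt (Icc_mem_nhds ht.1 ht.2)⟩

/-- The truncation of a real number to the interval `[-M, M]`. -/
noncomputable def clip (M x : ℝ) : ℝ := max (-M) (min M x)

lemma lipschitzWith_clip (M : ℝ) : LipschitzWith 1 (clip M) :=
  (LipschitzWith.id.const_min M).const_max (-M)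

lemma abs_clip_le {M : ℝ} (hM : 0 ≤ M) (x : ℝ) : |clip M x| ≤ M :=
  abs_le.2 ⟨le_max_left _ _, max_le (by linarith) (min_le_left _ _)⟩

lemma clip_eq_self {M x : ℝ} (hx : |x| ≤ M) : clip M x = x := by
  obtain ⟨h1, h2⟩ := abs_le.1 hx
  rw [clip, min_eq_right h2, max_eq_right h1]

/-- The phase-plane vector field of `x'' = -h x`, with both coordinates truncated. -/
noncomputable def clippedField (h : ℝ → ℝ) (M : ℝ) (q : ℝ × ℝ) : ℝ × ℝ :=
  (clip M q.2, -h (clip M q.1))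

lemma exists_lipschitzWith_clippedField {h : ℝ → ℝ} (hh : LocallyLipschitz h) {M : ℝ}
    (hM : 0 ≤ M) : ∃ K L : NNReal, LipschitzWith K (clippedField h M) ∧
      ∀ q, ‖clippedField h M q‖ ≤ L := by
  obtain ⟨K, hK⟩ := (hh.locallyLipschitzOn (s := Icc (-M) M)).exists_lipschitzOnWith_of_compact
    isCompact_Icc
  obtain ⟨C, hC⟩ := isCompact_Icc.exists_bound_of_continuousOn
    (hh.continuous.continuousOn (s := Icc (-M) M))
  have hmem : ∀ x, clip M x ∈ Icc (-M) M := fun x => abs_le.1 (abs_clip_le hM x)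
  have hhc : LipschitzWith (K * 1) (fun x => h (clip M x)) := by
    rw [← lipschitzOnWith_univ]
    exact hK.comp (lipschitzWith_clip M).lipschitzOnWith (fun x _ => hmem x)
  refine ⟨_, ⟨max M C, hM.trans (le_max_left _ _)⟩,
    ((lipschitzWith_clip M).comp LipschitzWith.prod_snd).prodMk
      (hhc.comp LipschitzWith.prod_fst).neg, fun q => ?_⟩
  refine norm_prod_le_iff.2 ⟨(abs_clip_le hM _).trans (le_max_left _ _), ?_⟩
  rw [clippedField, norm_neg]
  exact (hC _ (hmem _)).trans (le_max_right _ _)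

/-- A solution of `x'' = -h x` on `(0, ρ)` which is bounded together with its derivative
extends beyond `ρ`. -/
lemma exists_extension_of_bounded {h : ℝ → ℝ} (hh : LocallyLipschitz h) {ρ A B : ℝ} (hρ : 0 < ρ)
    {u p : ℝ → ℝ} (hu : ∀ t ∈ Ioo 0 ρ, HasDerivAt u (p t) t)
    (hp : ∀ t ∈ Ioo 0 ρ, HasDerivAt p (-h (u t)) t)
    (hA : ∀ t ∈ Ioo 0 ρ, |u t| ≤ A) (hB : ∀ t ∈ Ioo 0 ρ, |p t| ≤ B) :
    ∃ δ > 0, ∃ x y : ℝ → ℝ, (∀ t ∈ Ico (ρ / 2) ρ, x t = u t) ∧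
      ∀ t ∈ Ioo (ρ / 2) (ρ + δ), HasDerivAt x (y t) t ∧ HasDerivAt y (-h (x t)) t := by
  have hA0 : 0 ≤ A := (abs_nonneg _).trans (hA (ρ / 2) ⟨by linarith, by linarith⟩)
  set M : ℝ := max A B + 1 with hMdef
  have hAM : A < M := by linarith [le_max_left A B]
  have hBM : B < M := by linarith [le_max_right A B]
  obtain ⟨K, L, hK, hL⟩ := exists_lipschitzWith_clippedField hh (hA0.trans hAM.le)
  obtain ⟨γ, hγ0, hγ⟩ := exists_hasDerivAt_of_lipschitzWith_of_norm_le hK hL (ρ / 2) hρ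
    (u (ρ / 2), p (ρ / 2))
  have heq : ∀ t ∈ Ico (ρ / 2) ρ, γ t = (u t, p t) := by
    intro t ht
    have hsub : ∀ s ∈ Icc (ρ / 2) t, s ∈ Ioo 0 ρ := fun s hs =>
      ⟨by linarith [hs.1], hs.2.trans_lt ht.2⟩
    have hsub' : ∀ s ∈ Icc (ρ / 2) t, s ∈ Ioo (ρ / 2 - ρ) (ρ / 2 + ρ) := fun s hs =>
      ⟨by linarith [hs.1], by linarith [hs.2, ht.2]⟩
    have hup : ∀ s ∈ Icc (ρ / 2) t,
        HasDerivAt (fun s => (u s, p s)) (clippedField h M (u s, p s)) s := by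
      intro s hs
      have hs' := hsub s hs
      simp only [clippedField, clip_eq_self ((hA s hs').trans hAM.le),
        clip_eq_self ((hB s hs').trans hBM.le)]
      exact (hu s hs').prodMk (hp s hs')
    exact ODE_solution_unique (v := fun _ => clippedField h M) (fun _ => hK)
      (fun s hs => (hγ s (hsub' s hs)).continuousAt.continuousWithinAt)
      (fun s hs => (hγ s (hsub' s (Ico_subset_Icc_self hs))).hasDerivWithinAt)
      (fun s hs => (hup s hs).continuousAt.continuousWithinAt)
      (fun s hs => (hup s (Ico_subset_Icc_self hs)).hasDerivWithinAt)
      hγ0 ⟨ht.1, le_rfl⟩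
  have hcont : ContinuousAt γ ρ := (hγ ρ ⟨by linarith, by linarith⟩).continuousAt
  have hIco : ∀ᶠ t in 𝓝[<] ρ, t ∈ Ico (ρ / 2) ρ := Ico_mem_nhdsLT (by linarith)
  have hAρ : |(γ ρ).1| ≤ A := by
    refine le_of_tendsto ((continuous_abs.comp continuous_fst).continuousAt.tendsto.comp
      (hcont.tendsto.mono_left (nhdsWithin_le_nhds (s := Iio ρ)))) ?_
    filter_upwards [hIco] with t ht
    simpa [heq t ht] using hA t ⟨by linarith [ht.1], ht.2⟩
  have hBρ : |(γ ρ).2| ≤ B := by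
    refine le_of_tendsto ((continuous_abs.comp continuous_snd).continuousAt.tendsto.comp
      (hcont.tendsto.mono_left (nhdsWithin_le_nhds (s := Iio ρ)))) ?_
    filter_upwards [hIco] with t ht
    simpa [heq t ht] using hB t ⟨by linarith [ht.1], ht.2⟩
  have hnear : ∀ᶠ t in 𝓝 ρ, |(γ t).1| < M ∧ |(γ t).2| < M :=
    (((continuous_abs.comp continuous_fst).continuousAt.comp hcont).eventually_lt
      continuousAt_const (hAρ.trans_lt hAM)).and
    (((continuous_abs.comp continuous_snd).continuousAt.comp hcont).eventually_lt
      continuousAt_const (hBρ.trans_lt hBM))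
  obtain ⟨ε, hε, hball⟩ := Metric.eventually_nhds_iff.1 hnear
  refine ⟨min ε (ρ / 2), lt_min hε (by linarith), fun t => (γ t).1, fun t => (γ t).2,
    fun t ht => by simp [heq t ht], fun t ht => ?_⟩
  have hδ1 := min_le_left ε (ρ / 2)
  have hδ2 := min_le_right ε (ρ / 2)
  have hM : |(γ t).1| ≤ M ∧ |(γ t).2| ≤ M := by
    rcases lt_or_ge t ρ with htρ | htρ
    · have ht' : t ∈ Ioo 0 ρ := ⟨by linarith [ht.1], htρ⟩
      rw [heq t ⟨ht.1.le, htρ⟩]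
      exact ⟨(hA t ht').trans hAM.le, (hB t ht').trans hBM.le⟩
    · have := hball (y := t) (by rw [Real.dist_eq, abs_lt]; constructor <;> linarith [ht.2])
      exact ⟨this.1.le, this.2.le⟩
  have hd := hγ t ⟨by linarith [ht.1], by linarith [ht.2]⟩
  have h1 := hd.fst
  have h2 := hd.snd
  simp only [clippedField, clip_eq_self hM.1, clip_eq_self hM.2] at h1 h2
  exact ⟨h1, h2⟩

/-- `u` solves `u'' = -h u` on `[0, T]` with velocity `p` and `u' = 0` at time `0`. -/
structure IsRestTrajectory (h u p : ℝ → ℝ) (T : ℝ) : Prop where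
  continuousOn : ContinuousOn u (Icc 0 T)
  continuousOn_velocity : ContinuousOn p (Icc 0 T)
  hasDerivAt : ∀ r ∈ Ioo 0 T, HasDerivAt u (p r) r
  hasDerivAt_velocity : ∀ r ∈ Ioo 0 T, HasDerivAt p (-h (u r)) r
  velocity_zero : p 0 = 0

/-- `P` is a potential for `h` whose sublevel well at height `P ξ` within `[-α, α]` is `[-α, ξ]`,
where `-α` is an equilibrium and `ξ` is not. -/
structure IsHeteroclinicWell (h P : ℝ → ℝ) (α ξ : ℝ) : Prop where
  locallyLipschitz : LocallyLipschitz h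
  hasDerivAt : ∀ x, HasDerivAt P (h x) x
  neg_lt : -α < ξ
  lt : ξ < α
  apply_neg : h (-α) = 0
  apply_ne_zero : h ξ ≠ 0
  potential_neg : P (-α) = P ξ
  potential_lt : ∀ x ∈ Ioo (-α) ξ, P x < P ξ
  lt_potential : ∀ x ∈ Ioc ξ α, P ξ < P x

namespace IsRestTrajectory

variable {h u p P : ℝ → ℝ} {T α ξ : ℝ}

lemma mono (H : IsRestTrajectory h u p T) {r : ℝ} (hr : r ≤ T) : IsRestTrajectory h u p r where
  continuousOn := H.continuousOn.mono (Icc_subset_Icc_right hr)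
  continuousOn_velocity := H.continuousOn_velocity.mono (Icc_subset_Icc_right hr)
  hasDerivAt s hs := H.hasDerivAt s ⟨hs.1, hs.2.trans_le hr⟩
  hasDerivAt_velocity s hs := H.hasDerivAt_velocity s ⟨hs.1, hs.2.trans_le hr⟩
  velocity_zero := H.velocity_zero

lemma energy_eq (H : IsRestTrajectory h u p T) (hP : ∀ x, HasDerivAt P (h x) x) {r : ℝ}
    (hr : r ∈ Icc 0 T) : p r ^ 2 / 2 + P (u r) = P (u 0) := by
  have hPc : Continuous P := continuous_iff_continuousAt.2 fun x => (hP x).continuousAt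
  rcases hr.1.eq_or_lt with rfl | hr0
  · simp [H.velocity_zero]
  have H' := H.mono hr.2
  obtain ⟨c, -, hc⟩ := exists_hasDerivAt_eq_slope (fun s => p s ^ 2 / 2 + P (u s))
    (fun _ => 0) hr0
    (((H'.continuousOn_velocity.pow 2).div_const 2).add (hPc.comp_continuousOn H'.continuousOn))
    (fun s hs => by
      have h1 := (((H'.hasDerivAt_velocity s hs).pow 2).div_const 2).add
        ((hP (u s)).comp s (H'.hasDerivAt s hs))
      convert! h1 using 1
      push_cast
      ring)
  rw [eq_div_iff (by linarith : r - 0 ≠ 0)] at hc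
  simp only [H.velocity_zero] at hc
  linarith

/-- A trajectory starting at `ξ` cannot reach the equilibrium `-α` of the same energy. -/
lemma ne_neg (H : IsRestTrajectory h u p T) (W : IsHeteroclinicWell h P α ξ) (h0 : u 0 = ξ)
    {r : ℝ} (hr : r ∈ Icc 0 T) : u r ≠ -α := by
  intro hur
  have H' := H.mono hr.2
  obtain ⟨M, hM⟩ := isCompact_Icc.exists_bound_of_continuousOn H'.continuousOn
  obtain ⟨K, hK⟩ := (W.locallyLipschitz.locallyLipschitzOn
    (s := Icc (-M) M)).exists_lipschitzOnWith_of_compact isCompact_Icc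
  have hbd : ∀ s ∈ Icc 0 r, u s ∈ Icc (-M) M := fun s hs => abs_le.1 (hM s hs)
  have hαM : -α ∈ Icc (-M) M := hur ▸ hbd r ⟨hr.1, le_rfl⟩
  have hvel : ∀ s ∈ Icc 0 r, p s ^ 2 ≤ 2 * K * (u s + α) ^ 2 := by
    intro s hs
    have hE := H'.energy_eq W.hasDerivAt hs
    rw [h0, ← W.potential_neg] at hE
    have hsub : uIcc (-α) (u s) ⊆ Icc (-M) M := ordConnected_Icc.uIcc_subset hαM (hbd s hs)
    have hest := (convex_uIcc (-α) (u s)).norm_image_sub_le_of_norm_hasDerivWithin_le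
      (f := P) (f' := h) (C := K * |u s + α|) (fun x _ => (W.hasDerivAt x).hasDerivWithinAt)
      (fun x hx => by
        have h1 := hK.dist_le_mul x (hsub hx) (-α) hαM
        rw [W.apply_neg, Real.dist_eq, Real.dist_eq, sub_zero] at h1
        refine h1.trans (mul_le_mul_of_nonneg_left ?_ K.2)
        have h2 := abs_sub_left_of_mem_uIcc hx
        simpa only [sub_neg_eq_add] using h2)
      left_mem_uIcc right_mem_uIcc
    rw [Real.norm_eq_abs, Real.norm_eq_abs, sub_neg_eq_add, mul_assoc, abs_mul_abs_self] at hest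
    have := (abs_le.1 hest).1
    nlinarith
  have hmono : MonotoneOn (fun s => (u s + α) ^ 2 * Real.exp ((1 + 2 * K) * s)) (Icc 0 r) := by
    refine monotoneOn_of_hasDerivWithinAt_nonneg (convex_Icc 0 r)
      (f' := fun s => (2 * (u s + α) * p s + (1 + 2 * K) * (u s + α) ^ 2)
        * Real.exp ((1 + 2 * K) * s))
      (((H'.continuousOn.add continuousOn_const).pow 2).mul (by fun_prop)) ?_ ?_
    · intro s hs
      rw [interior_Icc] at hs
      have h1 := (((H'.hasDerivAt s hs).add_const α).pow 2).mul
        (((hasDerivAt_id s).const_mul (1 + 2 * (K : ℝ))).exp)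
      refine HasDerivAt.hasDerivWithinAt ?_
      convert! h1 using 1
      simp
      ring
    · intro s hs
      rw [interior_Icc] at hs
      have := hvel s (Ioo_subset_Icc_self hs)
      refine mul_nonneg ?_ (Real.exp_pos _).le
      nlinarith [sq_nonneg (u s + α + p s)]
  have := hmono (left_mem_Icc.2 hr.1) (right_mem_Icc.2 hr.1) hr.1
  simp only [hur, h0, mul_zero, Real.exp_zero, mul_one, neg_add_cancel] at this
  nlinarith [W.neg_lt]

lemma mem_Ioo (H : IsRestTrajectory h u p T) (W : IsHeteroclinicWell h P α ξ) (h0 : u 0 = ξ)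
    {r : ℝ} (hr : r ∈ Icc 0 T) : u r ∈ Ioo (-α) α := by
  have hc := (H.mono hr.2).continuousOn
  constructor
  · by_contra! hle
    obtain ⟨s, hs, hus⟩ := intermediate_value_Icc' hr.1 hc ⟨hle, h0 ▸ W.neg_lt.le⟩
    exact H.ne_neg W h0 ⟨hs.1, hs.2.trans hr.2⟩ hus
  · by_contra! hle
    obtain ⟨s, hs, hus⟩ := intermediate_value_Icc hr.1 hc ⟨h0 ▸ W.lt.le, hle⟩
    have hE := H.energy_eq W.hasDerivAt ⟨hs.1, hs.2.trans hr.2⟩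
    rw [h0, hus] at hE
    nlinarith [W.lt_potential α ⟨W.lt, le_rfl⟩, sq_nonneg (p s)]

lemma le_start (H : IsRestTrajectory h u p T) (W : IsHeteroclinicWell h P α ξ) (h0 : u 0 = ξ)
    {r : ℝ} (hr : r ∈ Icc 0 T) : u r ≤ ξ := by
  by_contra! hlt
  have hE := H.energy_eq W.hasDerivAt hr
  rw [h0] at hE
  nlinarith [W.lt_potential _ ⟨hlt, (H.mem_Ioo W h0 hr).2.le⟩, sq_nonneg (p r)]

lemma eq_start_of_velocity_eq_zero (H : IsRestTrajectory h u p T)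
    (W : IsHeteroclinicWell h P α ξ) (h0 : u 0 = ξ) {r : ℝ} (hr : r ∈ Icc 0 T) (hpr : p r = 0) :
    u r = ξ := by
  by_contra! hne
  have hE := H.energy_eq W.hasDerivAt hr
  have := W.potential_lt _ ⟨(H.mem_Ioo W h0 hr).1, (H.le_start W h0 hr).lt_of_ne hne⟩
  simp only [h0, hpr] at hE
  linarith

lemma velocity_ne_zero (H : IsRestTrajectory h u p T) (W : IsHeteroclinicWell h P α ξ)
    (h0 : u 0 = ξ) {r : ℝ} (hr : r ∈ Ioc 0 T) : p r ≠ 0 := by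
  intro hpr
  have H' := H.mono hr.2
  have hur := H.eq_start_of_velocity_eq_zero W h0 (Ioc_subset_Icc_self hr) hpr
  obtain ⟨m, hm, hmin⟩ := isCompact_Icc.exists_isMinOn (nonempty_Icc.2 hr.1.le) H'.continuousOn
  have hum : u m = ξ := by
    rcases hm.1.eq_or_lt with rfl | hm0
    · exact h0
    rcases hm.2.eq_or_lt with rfl | hmr
    · exact hur
    exact H'.eq_start_of_velocity_eq_zero W h0 hm
      ((hmin.isLocalMin (Icc_mem_nhds hm0 hmr)).hasDerivAt_eq_zero (H'.hasDerivAt m ⟨hm0, hmr⟩))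
  have hconst : ∀ s ∈ Icc 0 r, u s = ξ := fun s hs =>
    (H'.le_start W h0 hs).antisymm (hum ▸ hmin hs)
  have hp0 : ∀ s ∈ Ioo 0 r, p s = 0 := fun s hs =>
    (H'.hasDerivAt s hs).unique ((hasDerivAt_const s ξ).congr_of_eventuallyEq
      (by filter_upwards [Ioo_mem_nhds hs.1 hs.2] with t ht using hconst t (Ioo_subset_Icc_self ht)))
  have hmid : r / 2 ∈ Ioo 0 r := ⟨by linarith [hr.1], by linarith [hr.1]⟩
  have := (H'.hasDerivAt_velocity _ hmid).unique ((hasDerivAt_const _ (0 : ℝ)).congr_of_eventuallyEq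
    (by filter_upwards [Ioo_mem_nhds hmid.1 hmid.2] with t ht using hp0 t ht))
  rw [hconst _ (Ioo_subset_Icc_self hmid), neg_eq_zero] at this
  exact W.apply_ne_zero this

lemma velocity_neg (H : IsRestTrajectory h u p T) (W : IsHeteroclinicWell h P α ξ)
    (h0 : u 0 = ξ) {r : ℝ} (hr : r ∈ Ioc 0 T) : p r < 0 := by
  by_contra! hpr
  have H' := H.mono hr.2
  obtain ⟨c, hc, hslope⟩ := exists_hasDerivAt_eq_slope u p hr.1 H'.continuousOn H'.hasDerivAt
  have hpc : p c ≤ 0 := by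
    rw [hslope, h0]
    exact div_nonpos_of_nonpos_of_nonneg
      (sub_nonpos.2 (H'.le_start W h0 ⟨hr.1.le, le_rfl⟩)) (by linarith [hr.1])
  obtain ⟨s, hs, hps⟩ := intermediate_value_Icc hc.2.le
    (H'.continuousOn_velocity.mono (Icc_subset_Icc_left hc.1.le)) ⟨hpc, hpr⟩
  exact H'.velocity_ne_zero W h0 ⟨hc.1.trans_le hs.1, hs.2⟩ hps

/-- The velocity is bounded in terms of the potential on `[-α, ξ]` only. -/
lemma exists_abs_velocity_le (W : IsHeteroclinicWell h P α ξ) :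
    ∃ B : ℝ, ∀ u p T, IsRestTrajectory h u p T → u 0 = ξ → ∀ r ∈ Icc 0 T, |p r| ≤ B := by
  have hPc : Continuous P := continuous_iff_continuousAt.2 fun x => (W.hasDerivAt x).continuousAt
  obtain ⟨C, hC⟩ := isCompact_Icc.exists_bound_of_continuousOn (hPc.continuousOn (s := Icc (-α) ξ))
  refine ⟨1 + 4 * C, fun u p T H h0 r hr => ?_⟩
  have hE := H.energy_eq W.hasDerivAt hr
  have h1 := abs_le.1 (hC (u r) ⟨(H.mem_Ioo W h0 hr).1.le, H.le_start W h0 hr⟩)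
  have h2 := abs_le.1 (hC ξ ⟨W.neg_lt.le, le_rfl⟩)
  rw [h0] at hE
  have hsq : p r ^ 2 ≤ 4 * C := by linarith [h1.1, h2.2]
  nlinarith [sq_abs (p r), sq_nonneg (|p r| - 1)]

lemma strictAntiOn (H : ∀ T > 0, IsRestTrajectory h u p T) (W : IsHeteroclinicWell h P α ξ)
    (h0 : u 0 = ξ) : StrictAntiOn u (Ioi 0) := by
  have hd : ∀ r ∈ Ioi (0 : ℝ), HasDerivAt u (p r) r := fun r hr =>
    (H (r + 1) (by linarith [mem_Ioi.1 hr])).hasDerivAt r ⟨hr, by linarith⟩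
  refine strictAntiOn_of_hasDerivWithinAt_neg (convex_Ioi 0)
    (fun r hr => (hd r hr).continuousAt.continuousWithinAt)
    (fun r hr => (hd r (interior_subset hr)).hasDerivWithinAt)
    (fun r hr => ?_)
  have hr := interior_subset hr
  exact (H r hr).velocity_neg W h0 ⟨hr, le_rfl⟩

lemma tendsto_neg (H : ∀ T > 0, IsRestTrajectory h u p T) (W : IsHeteroclinicWell h P α ξ)
    (h0 : u 0 = ξ) : Tendsto u atTop (𝓝 (-α)) := by
  have hPc : Continuous P := continuous_iff_continuousAt.2 fun x => (W.hasDerivAt x).continuousAt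
  have hanti := strictAntiOn H W h0
  have hlow : ∀ r > 0, -α < u r := fun r hr => ((H r hr).mem_Ioo W h0 ⟨hr.le, le_rfl⟩).1
  suffices hcross : ∀ a, -α < a → ∃ r ≥ 1, u r < a by
    refine tendsto_order.2 ⟨fun a ha => ?_, fun a ha => ?_⟩
    · filter_upwards [eventually_gt_atTop 0] with r hr using ha.trans (hlow r hr)
    · obtain ⟨r, hr, hra⟩ := hcross a ha
      filter_upwards [eventually_ge_atTop r] with s hs
      exact (hanti.antitoneOn (mem_Ioi.2 (by linarith)) (mem_Ioi.2 (by linarith)) hs).trans_lt hra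
  intro a ha
  by_contra! hge
  have hu1 : u 1 < ξ := by
    have h1 := (H 1 one_pos)
    refine (h1.le_start W h0 ⟨zero_le_one, le_rfl⟩).lt_of_ne fun heq => ?_
    have := h1.energy_eq W.hasDerivAt ⟨zero_le_one, le_rfl⟩
    have hneg := h1.velocity_neg W h0 ⟨one_pos, le_rfl⟩
    rw [h0, heq] at this
    nlinarith
  obtain ⟨m, hm, hmax⟩ := isCompact_Icc.exists_isMaxOn (nonempty_Icc.2 (hge 1 le_rfl))
    hPc.continuousOn
  have hPm : P m < P ξ := W.potential_lt m ⟨ha.trans_le hm.1, hm.2.trans_lt hu1⟩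
  set k : ℝ := √(2 * (P ξ - P m))
  have hkpos : 0 < k := Real.sqrt_pos.2 (by linarith)
  have hksq : k ^ 2 = 2 * (P ξ - P m) := Real.sq_sqrt (by linarith)
  have hvel : ∀ r ≥ 1, p r ≤ -k := by
    intro r hr
    have hr0 : 0 < r := by linarith
    have hE := (H r hr0).energy_eq W.hasDerivAt ⟨hr0.le, le_rfl⟩
    have hneg := (H r hr0).velocity_neg W h0 ⟨hr0, le_rfl⟩
    have hPu : P (u r) ≤ P m :=
      hmax ⟨hge r hr, hanti.antitoneOn (mem_Ioi.2 one_pos) (mem_Ioi.2 hr0) hr⟩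
    rw [h0] at hE
    nlinarith
  have hr1 : 1 < 1 + (u 1 + α + 1) / k := by
    have := hlow 1 one_pos
    have : 0 < (u 1 + α + 1) / k := div_pos (by linarith) hkpos
    linarith
  set r : ℝ := 1 + (u 1 + α + 1) / k with hrdef
  have H' := H (r + 1) (by linarith)
  obtain ⟨c, hc, hslope⟩ := exists_hasDerivAt_eq_slope u p hr1
    (H'.continuousOn.mono (Icc_subset_Icc zero_le_one (by linarith)))
    (fun s hs => H'.hasDerivAt s ⟨by linarith [hs.1], by linarith [hs.2]⟩)
  have hle := hvel c hc.1.le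
  rw [hslope, div_le_iff₀ (by linarith), hrdef, add_sub_cancel_left, neg_mul,
    mul_div_cancel₀ _ hkpos.ne'] at hle
  linarith [hlow r (by linarith)]

end IsRestTrajectory

section Pucci

variable {lam Lam : ℝ}

/-- The force of the equation `M⁺(u'') + g(u) = 0` solved for `-u''`. -/
noncomputable def pucciForce (lam Lam : ℝ) (g : ℝ → ℝ) (x : ℝ) : ℝ := max (g x / lam) (g x / Lam)

lemma pucci_add_eq_zero_iff (hlam : 0 < lam) (hlamLam : lam ≤ Lam) (w c : ℝ) :
    (if 0 ≤ w then Lam * w else lam * w) + c = 0 ↔ w = -max (c / lam) (c / Lam) := by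
  have hLam : 0 < Lam := hlam.trans_le hlamLam
  rcases le_total 0 c with hc | hc
  · rw [max_eq_left (div_le_div_of_nonneg_left hc hlam hlamLam), eq_neg_iff_add_eq_zero]
    split_ifs with hw
    · have h0 : 0 ≤ c / lam := by positivity
      constructor
      · intro h
        have hw0 : w = 0 := by nlinarith
        have hc0 : c = 0 := by rw [hw0] at h; linarith
        simp [hw0, hc0]
      · intro h
        have hw0 : w = 0 := by linarith
        have hc0 : c / lam = 0 := by linarith
        rcases div_eq_zero_iff.1 hc0 with h | h
        · simp [hw0, h]
        · exact absurd h hlam.ne'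
    · constructor <;> intro h
      · field_simp; linarith
      · field_simp at h; linarith
  · have hle : c / lam ≤ c / Lam := by
      rw [div_le_div_iff₀ hlam hLam]; nlinarith
    rw [max_eq_right hle, eq_neg_iff_add_eq_zero]
    split_ifs with hw
    · constructor <;> intro h
      · field_simp; linarith
      · field_simp at h; linarith
    · have h0 : c / Lam ≤ 0 := div_nonpos_of_nonpos_of_nonneg hc hLam.le
      constructor <;> intro h
      · nlinarith
      · linarith

lemma locallyLipschitz_pucciForce {g : ℝ → ℝ} (hg : LocallyLipschitz g) :
    LocallyLipschitz (pucciForce lam Lam g) := by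
  have hdiv : ∀ c : ℝ, LocallyLipschitz fun x => g x / c := fun c => by
    have : LipschitzWith ‖c⁻¹‖₊ fun x : ℝ => x / c := by
      simpa only [div_eq_inv_mul, smul_eq_mul] using lipschitzWith_smul (β := ℝ) c⁻¹
    exact this.locallyLipschitz.comp hg
  exact (hdiv lam).max (hdiv Lam)

lemma pucciForce_of_nonneg (hlam : 0 < lam) (hlamLam : lam ≤ Lam) {g : ℝ → ℝ} {x : ℝ}
    (hx : 0 ≤ g x) : pucciForce lam Lam g x = g x / lam :=
  max_eq_left (div_le_div_of_nonneg_left hx hlam hlamLam)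

lemma pucciForce_of_nonpos (hlam : 0 < lam) (hlamLam : lam ≤ Lam) {g : ℝ → ℝ} {x : ℝ}
    (hx : g x ≤ 0) : pucciForce lam Lam g x = g x / Lam := by
  refine max_eq_right ?_
  rw [div_le_div_iff₀ hlam (hlam.trans_le hlamLam)]
  nlinarith

lemma isHeteroclinicWell_pucciForce (hlam : 0 < lam) (hlamLam : lam ≤ Lam) {g : ℝ → ℝ}
    (hg1 : LocallyLipschitz g) (hg2 : ∀ t, g (-t) = -g t) {α : ℝ} (hα : 0 < α)
    (hg3pos : ∀ t, 0 < t → t < α → 0 < g t) (hg3neg : ∀ t, α < t → g t < 0)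
    {ξ : ℝ} (hξ0 : 0 < ξ) (hξα : ξ < α)
    (hGeq : Lam * ∫ s in (0 : ℝ)..ξ, g s = lam * ∫ s in (0 : ℝ)..α, g s) :
    IsHeteroclinicWell (pucciForce lam Lam g)
      (fun x => ∫ s in (0 : ℝ)..x, pucciForce lam Lam g s) α ξ := by
  have hLam : 0 < Lam := hlam.trans_le hlamLam
  have hgc : Continuous g := hg1.continuous
  have hh := locallyLipschitz_pucciForce (lam := lam) (Lam := Lam) hg1
  have hg0 : g 0 = 0 := by have := hg2 0; simp at this; linarith
  have hgα : g α = 0 := by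
    refine le_antisymm ?_ ?_
    · refine le_of_tendsto (x := 𝓝[>] α) (hgc.continuousAt.tendsto.mono_left nhdsWithin_le_nhds) ?_
      filter_upwards [self_mem_nhdsWithin] with t ht using (hg3neg t ht).le
    · refine ge_of_tendsto (x := 𝓝[<] α) (hgc.continuousAt.tendsto.mono_left nhdsWithin_le_nhds) ?_
      filter_upwards [Ioo_mem_nhdsLT hα] with t ht using (hg3pos t ht.1 ht.2).le
  have hgnonneg : ∀ t ∈ Icc 0 α, 0 ≤ g t := by
    intro t ht
    rcases ht.1.eq_or_lt with rfl | h1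
    · exact hg0.ge
    rcases ht.2.eq_or_lt with rfl | h2
    · exact hgα.ge
    exact (hg3pos t h1 h2).le
  have hgnonpos : ∀ t ∈ Icc (-α) 0, g t ≤ 0 := by
    intro t ht
    have := hgnonneg (-t) ⟨by linarith [ht.2], by linarith [ht.1]⟩
    rw [hg2] at this
    linarith
  have hderiv : ∀ x, HasDerivAt (fun x => ∫ s in (0 : ℝ)..x, pucciForce lam Lam g s)
      (pucciForce lam Lam g x) x := fun x =>
    (hh.continuous.integral_hasStrictDerivAt 0 x).hasDerivAt
  have hneg : (∫ s in (0 : ℝ)..(-α), pucciForce lam Lam g s)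
      = ∫ s in (0 : ℝ)..ξ, pucciForce lam Lam g s := by
    have h1 : (∫ s in (0 : ℝ)..(-α), pucciForce lam Lam g s) = (∫ s in (0 : ℝ)..(-α), g s) / Lam := by
      rw [← intervalIntegral.integral_div]
      refine intervalIntegral.integral_congr fun s hs => ?_
      rw [uIcc_of_ge (by linarith)] at hs
      exact pucciForce_of_nonpos hlam hlamLam (hgnonpos s hs)
    have h2 : (∫ s in (0 : ℝ)..ξ, pucciForce lam Lam g s) = (∫ s in (0 : ℝ)..ξ, g s) / lam := by
      rw [← intervalIntegral.integral_div]
      refine intervalIntegral.integral_congr fun s hs => ?_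
      rw [uIcc_of_le hξ0.le] at hs
      exact pucciForce_of_nonneg hlam hlamLam (hgnonneg s ⟨hs.1, hs.2.trans hξα.le⟩)
    have h3 : (∫ s in (0 : ℝ)..(-α), g s) = ∫ s in (0 : ℝ)..α, g s := by
      have := intervalIntegral.integral_comp_neg (a := 0) (b := α) g
      simp only [hg2, intervalIntegral.integral_neg, neg_zero] at this
      rw [intervalIntegral.integral_symm, ← this, neg_neg]
    rw [h1, h2, h3, div_eq_div_iff hLam.ne' hlam.ne']
    linarith
  have hmono : StrictMonoOn (fun x => ∫ s in (0 : ℝ)..x, pucciForce lam Lam g s) (Icc 0 α) := by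
    refine strictMonoOn_of_hasDerivWithinAt_pos (convex_Icc 0 α)
      (fun x _ => (hderiv x).continuousAt.continuousWithinAt)
      (fun x _ => (hderiv x).hasDerivWithinAt) fun x hx => ?_
    rw [interior_Icc] at hx
    have := hg3pos x hx.1 hx.2
    rw [pucciForce_of_nonneg hlam hlamLam this.le]
    positivity
  have hanti : StrictAntiOn (fun x => ∫ s in (0 : ℝ)..x, pucciForce lam Lam g s)
      (Icc (-α) 0) := by
    refine strictAntiOn_of_hasDerivWithinAt_neg (convex_Icc (-α) 0)
      (fun x _ => (hderiv x).continuousAt.continuousWithinAt)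
      (fun x _ => (hderiv x).hasDerivWithinAt) fun x hx => ?_
    rw [interior_Icc] at hx
    have := hg3pos (-x) (by linarith [hx.2]) (by linarith [hx.1])
    rw [hg2] at this
    rw [pucciForce_of_nonpos hlam hlamLam (by linarith)]
    exact div_neg_of_neg_of_pos (by linarith) hLam
  exact
    { locallyLipschitz := hh
      hasDerivAt := hderiv
      neg_lt := by linarith
      lt := hξα
      apply_neg := by simp [pucciForce, hg2, hgα]
      apply_ne_zero := by
        have := hg3pos ξ hξ0 hξα
        rw [pucciForce_of_nonneg hlam hlamLam this.le]
        positivity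
      potential_neg := hneg
      potential_lt := fun x hx => by
        rcases le_total x 0 with hx0 | hx0
        · rw [← hneg]
          exact hanti ⟨le_rfl, by linarith⟩ ⟨hx.1.le, hx0⟩ hx.1
        · exact hmono ⟨hx0, (hx.2.trans hξα).le⟩ ⟨hξ0.le, hξα.le⟩ hx.2
      lt_potential := fun x hx =>
        hmono ⟨hξ0.le, hξα.le⟩ ⟨(hξ0.trans hx.1).le, hx.2⟩ hx.1 }

end Pucci

/-- A `C²` solution of `u'' = -h u` on `[0, R)`, in terms of two-sided derivatives, starting from
rest at a point which is not an equilibrium, is a trajectory on every `[0, T]` with `T < R`. -/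
lemma isRestTrajectory_of_contDiffOn {h u : ℝ → ℝ} {R : EReal}
    (hu : ContDiffOn ℝ 2 u {r : ℝ | 0 ≤ r ∧ (r : EReal) < R})
    (hode : ∀ r : ℝ, 0 ≤ r → (r : EReal) < R → deriv (deriv u) r = -h (u r))
    (hne : h (u 0) ≠ 0) (hu'0 : deriv u 0 = 0) {T : ℝ} (hTR : (T : EReal) < R) :
    IsRestTrajectory h u (deriv u) T := by
  have hlt : ∀ r ≤ T, (r : EReal) < R := fun r hr => (EReal.coe_le_coe_iff.2 hr).trans_lt hTR
  have hat : ∀ r : ℝ, 0 < r → (r : EReal) < R → ContDiffAt ℝ 2 u r := fun r hr hrR => by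
    refine hu.contDiffAt ?_
    have h1 : ∀ᶠ s : ℝ in 𝓝 r, (s : EReal) < R :=
      continuous_coe_real_ereal.continuousAt.eventually_lt continuousAt_const hrR
    filter_upwards [h1, eventually_gt_nhds hr] with s h1 h2 using ⟨h2.le, h1⟩
  have hd1 : ∀ r : ℝ, 0 < r → (r : EReal) < R → HasDerivAt u (deriv u r) r := fun r hr hrR =>
    ((hat r hr hrR).differentiableAt (by norm_num)).hasDerivAt
  have hd2 : ∀ r : ℝ, 0 ≤ r → (r : EReal) < R → HasDerivAt (deriv u) (-h (u r)) r := by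
    intro r hr hrR
    rw [← hode r hr hrR]
    refine DifferentiableAt.hasDerivAt ?_
    rcases hr.eq_or_lt with rfl | hr
    · refine differentiableAt_of_deriv_ne_zero ?_
      rw [hode 0 le_rfl hrR]
      exact neg_ne_zero.2 hne
    · have : ContDiffAt ℝ 1 (deriv u) r := (hat r hr hrR).derivWithin (by norm_num)
      exact this.differentiableAt (by norm_num)
  exact
    { continuousOn := hu.continuousOn.mono fun r hr => ⟨hr.1, hlt r hr.2⟩
      continuousOn_velocity := fun r hr =>
        (hd2 r hr.1 (hlt r hr.2)).continuousAt.continuousWithinAt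
      hasDerivAt := fun r hr => hd1 r hr.1 (hlt r hr.2.le)
      hasDerivAt_velocity := fun r hr => hd2 r hr.1.le (hlt r hr.2.le)
      velocity_zero := hu'0 }

/-- Gluing a continuation past `ρ` to a `C²` solution of `u'' = -h u` on `[0, ρ)`. -/
lemma exists_glued_solution {h u x y : ℝ → ℝ} {ρ δ : ℝ} (hρ : 0 < ρ)
    (hh : Continuous h)
    (hu : ContDiffOn ℝ 2 u (Ico 0 ρ))
    (hode : ∀ r ∈ Ico 0 ρ, deriv (deriv u) r = -h (u r))
    (hxu : ∀ t ∈ Ico (ρ / 2) ρ, x t = u t)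
    (hxy : ∀ t ∈ Ioo (ρ / 2) (ρ + δ), HasDerivAt x (y t) t ∧ HasDerivAt y (-h (x t)) t) :
    ∃ v : ℝ → ℝ, (∀ r < ρ, v =ᶠ[𝓝 r] u) ∧ ContDiffOn ℝ 2 v (Ico 0 (ρ + δ)) ∧
      ∀ r ∈ Ico 0 (ρ + δ), deriv (deriv v) r = -h (v r) := by
  classical
  set v : ℝ → ℝ := fun r => if r < ρ then u r else x r with hv
  have hvu : ∀ r < ρ, v =ᶠ[𝓝 r] u := fun r hr => by
    filter_upwards [eventually_lt_nhds hr] with s hs using if_pos hs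
  have hvx : ∀ r > ρ / 2, v =ᶠ[𝓝 r] x := fun r hr => by
    filter_upwards [eventually_gt_nhds hr] with s hs
    by_cases hsρ : s < ρ
    · rw [hv]; simp only [if_pos hsρ]; exact (hxu s ⟨hs.le, hsρ⟩).symm
    · exact if_neg hsρ
  have hdx : ∀ r ∈ Ioo (ρ / 2) (ρ + δ), deriv x =ᶠ[𝓝 r] y := fun r hr => by
    filter_upwards [Ioo_mem_nhds hr.1 hr.2] with s hs using (hxy s hs).1.deriv
  have hx2 : ContDiffOn ℝ 2 x (Ioo (ρ / 2) (ρ + δ)) := by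
    have hd : ∀ r ∈ Ioo (ρ / 2) (ρ + δ), HasDerivAt (deriv x) (-h (x r)) r := fun r hr =>
      (hxy r hr).2.congr_of_eventuallyEq (hdx r hr)
    rw [show (2 : WithTop ℕ∞) = 1 + 1 by norm_num, contDiffOn_succ_iff_deriv_of_isOpen isOpen_Ioo]
    refine ⟨fun r hr => (hxy r hr).1.differentiableAt.differentiableWithinAt, by simp, ?_⟩
    rw [show (1 : WithTop ℕ∞) = 0 + 1 by norm_num, contDiffOn_succ_iff_deriv_of_isOpen isOpen_Ioo]
    refine ⟨fun r hr => (hd r hr).differentiableAt.differentiableWithinAt, by simp, ?_⟩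
    rw [contDiffOn_zero]
    refine ContinuousOn.congr (f := fun r => -h (x r)) (fun r hr => ?_) fun r hr => (hd r hr).deriv
    exact (hh.continuousAt.comp (hxy r hr).1.continuousAt).neg.continuousWithinAt
  refine ⟨v, hvu, fun r hr => ?_, fun r hr => ?_⟩
  · rcases lt_or_ge r ρ with hrρ | hrρ
    · have h1 : ContDiffWithinAt ℝ 2 v (Ico 0 ρ) r :=
        (hu r ⟨hr.1, hrρ⟩).congr_of_eventuallyEq ((hvu r hrρ).filter_mono nhdsWithin_le_nhds)
          (hvu r hrρ).self_of_nhds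
      refine h1.mono_of_mem_nhdsWithin ?_
      filter_upwards [self_mem_nhdsWithin, nhdsWithin_le_nhds (eventually_lt_nhds hrρ)]
        with s h1 h2 using ⟨h1.1, h2⟩
    · have hr2 : ρ / 2 < r := by linarith
      exact ((hx2.contDiffAt (Ioo_mem_nhds hr2 hr.2)).congr_of_eventuallyEq
        (hvx r hr2)).contDiffWithinAt
  · rcases lt_or_ge r ρ with hrρ | hrρ
    · rw [(hvu r hrρ).deriv.deriv_eq, (hvu r hrρ).self_of_nhds]
      exact hode r ⟨hr.1, hrρ⟩
    · have hr2 : ρ / 2 < r := by linarith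
      rw [(hvx r hr2).deriv.deriv_eq, (hdx r ⟨hr2, hr.2⟩).deriv_eq, (hvx r hr2).self_of_nhds]
      exact (hxy r ⟨hr2, hr.2⟩).2.deriv

theorem pucci_1d_plus_heteroclinic_case
    (lam Lam : ℝ) (hlam : 0 < lam) (hlamLam : lam ≤ Lam)
    (g : ℝ → ℝ) (hg1 : LocallyLipschitz g)
    (hg2 : ∀ t, g (-t) = - g t)
    (α : ℝ) (hα : 0 < α)
    (hg3pos : ∀ t, 0 < t → t < α → 0 < g t)
    (hg3neg : ∀ t, α < t → g t < 0)
    (G : ℝ → ℝ) (hG : ∀ t, G t = ∫ s in (0:ℝ)..t, g s)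
    (ξ : ℝ) (hξ0 : 0 < ξ) (hξα : ξ < α)
    (hGeq : Lam * G ξ = lam * G α)
    (R : EReal) (hR : 0 < R)
    (u : ℝ → ℝ)
    (hu : ContDiffOn ℝ 2 u {r : ℝ | 0 ≤ r ∧ (r : EReal) < R})
    (hode : ∀ r : ℝ, 0 ≤ r → (r : EReal) < R →
      (if 0 ≤ deriv (deriv u) r then Lam * deriv (deriv u) r
        else lam * deriv (deriv u) r) + g (u r) = 0)
    (hu0 : u 0 = ξ) (hu'0 : deriv u 0 = 0)
    (hmax : ¬ ∃ (R' : EReal) (v : ℝ → ℝ), R < R' ∧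
      ContDiffOn ℝ 2 v {r : ℝ | 0 ≤ r ∧ (r : EReal) < R'} ∧
      (∀ r : ℝ, 0 ≤ r → (r : EReal) < R' →
        (if 0 ≤ deriv (deriv v) r then Lam * deriv (deriv v) r
        else lam * deriv (deriv v) r) + g (v r) = 0) ∧
      v 0 = ξ ∧ deriv v 0 = 0 ∧
      (∀ r : ℝ, 0 ≤ r → (r : EReal) < R → v r = u r))
 :
    R = ⊤ ∧
    (∀ r, 0 ≤ r → -α < u r ∧ u r < α) ∧
    StrictAntiOn u (Set.Ioi 0) ∧
    Tendsto u atTop (𝓝 (-α)) := by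
  have hequiv := fun v : ℝ → ℝ => fun r : ℝ =>
    pucci_add_eq_zero_iff hlam hlamLam (deriv (deriv v) r) (g (v r))
  rw [hG, hG] at hGeq
  have W := isHeteroclinicWell_pucciForce hlam hlamLam hg1 hg2 hα hg3pos hg3neg hξ0 hξα hGeq
  have hode' : ∀ r : ℝ, 0 ≤ r → (r : EReal) < R →
      deriv (deriv u) r = -pucciForce lam Lam g (u r) := fun r hr hrR =>
    (hequiv u r).1 (hode r hr hrR)
  have htraj : ∀ T : ℝ, (T : EReal) < R →
      IsRestTrajectory (pucciForce lam Lam g) u (deriv u) T := fun T hTR =>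
    isRestTrajectory_of_contDiffOn hu hode' (hu0 ▸ W.apply_ne_zero) hu'0 hTR
  have hRtop : R = ⊤ := by
    by_contra hRne
    lift R to ℝ using ⟨hRne, (bot_le.trans_lt hR).ne'⟩ with ρ
    have hρ : 0 < ρ := by exact_mod_cast hR
    have hdom : ∀ ρ' : ℝ, {r : ℝ | 0 ≤ r ∧ (r : EReal) < (ρ' : EReal)} = Ico 0 ρ' := fun ρ' => by
      ext r; simp
    have hmem : ∀ t ∈ Ioo 0 ρ, ∃ T, t ∈ Ioo 0 T ∧
        IsRestTrajectory (pucciForce lam Lam g) u (deriv u) T := fun t ht => by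
      obtain ⟨T, hT1, hT2⟩ := exists_between ht.2
      exact ⟨T, ⟨ht.1, hT1⟩, htraj T (by exact_mod_cast hT2)⟩
    obtain ⟨B, hB⟩ := IsRestTrajectory.exists_abs_velocity_le W
    obtain ⟨δ, hδ, x, y, hxu, hxy⟩ := exists_extension_of_bounded W.locallyLipschitz hρ
      (u := u) (p := deriv u) (A := α) (B := B)
      (fun t ht => (hmem t ht).elim fun T hT => hT.2.hasDerivAt t hT.1)
      (fun t ht => (hmem t ht).elim fun T hT => hT.2.hasDerivAt_velocity t hT.1)
      (fun t ht => (hmem t ht).elim fun T hT => abs_le.2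
        ⟨(hT.2.mem_Ioo W hu0 (Ioo_subset_Icc_self hT.1)).1.le,
          (hT.2.mem_Ioo W hu0 (Ioo_subset_Icc_self hT.1)).2.le⟩)
      (fun t ht => (hmem t ht).elim fun T hT =>
        hB u _ T hT.2 hu0 t (Ioo_subset_Icc_self hT.1))
    rw [hdom] at hu
    obtain ⟨v, hvu, hv, hvode⟩ := exists_glued_solution hρ W.locallyLipschitz.continuous hu
      (fun r hr => hode' r hr.1 (by exact_mod_cast hr.2)) hxu hxy
    refine hmax ⟨((ρ + δ : ℝ) : EReal), v, by exact_mod_cast (by linarith : ρ < ρ + δ),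
      (hdom (ρ + δ)).symm ▸ hv,
      fun r hr hrR => (hequiv v r).2 (hvode r ⟨hr, by exact_mod_cast hrR⟩),
      (hvu 0 hρ).self_of_nhds.trans hu0, (hvu 0 hρ).deriv_eq.trans hu'0,
      fun r _ hrR => (hvu r (by exact_mod_cast hrR)).self_of_nhds⟩
  have H : ∀ T : ℝ, IsRestTrajectory (pucciForce lam Lam g) u (deriv u) T :=
    fun T => htraj T (hRtop ▸ EReal.coe_lt_top T)
  exact ⟨hRtop, fun r hr => (H r).mem_Ioo W hu0 ⟨hr, le_rfl⟩,
    IsRestTrajectory.strictAntiOn (fun T _ => H T) W hu0,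
    IsRestTrajectory.tendsto_neg (fun T _ => H T) W hu0⟩
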